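/- arXiv:2506.15499 — 2 statements merged into one kernel-verified Lean document; each statement's English description precedes it below -/
import Mathlib

section
/- (Neyman–Pearson lower-set comparison) Let μ be a finite measure on a measurable space Z, let r : Z → [0, ∞] be measurable, and let ν = μ.withDensity r. Fix t ∈ [0, ∞) and let S' = {z : r(z) ≤ t}. Then for every measurable set S with μ(S) ≥ μ(S'), one has ν(S) ≥ ν(S'). -/
open MeasureTheory
open scoped ENNReal

/-- Neyman–Pearson lower-set comparison: among all measurable sets of at least a given
`μ`-measure, a sublevel set of the density `r` minimizes the `μ.withDensity r`-measure. -/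
theorem neymanPearson_lowerSet {Z : Type*} [MeasurableSpace Z]
    (μ : Measure Z) [IsFiniteMeasure μ]
    (r : Z → ℝ≥0∞) (hr : Measurable r) (t : ℝ≥0∞) (ht : t ≠ ∞)
    (S : Set Z) (hS : MeasurableSet S)
    (hμ : μ {z | r z ≤ t} ≤ μ S) :
    (μ.withDensity r) {z | r z ≤ t} ≤ (μ.withDensity r) S := by
  set A : Set Z := {z | r z ≤ t}
  have hA : MeasurableSet A := measurableSet_le hr measurable_const
  have hdiff : μ (A \ S) ≤ μ (S \ A) := by
    rw [← measure_inter_add_sdiff A hS, ← measure_inter_add_sdiff S hA, Set.inter_comm S A] at hμ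
    exact (ENNReal.add_le_add_iff_left (measure_ne_top μ _)).mp hμ
  have hupper : μ.withDensity r (A \ S) ≤ t * μ (A \ S) := by
    rw [withDensity_apply _ (hA.diff hS), ← setLIntegral_const]
    exact setLIntegral_mono measurable_const fun z hz => hz.1
  have hlower : t * μ (S \ A) ≤ μ.withDensity r (S \ A) := by
    rw [withDensity_apply _ (hS.diff hA), ← setLIntegral_const]
    exact setLIntegral_mono hr fun z hz => (not_le.mp hz.2).le
  calc μ.withDensity r A
      = μ.withDensity r (A ∩ S) + μ.withDensity r (A \ S) := (measure_inter_add_sdiff A hS).symm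
    _ ≤ μ.withDensity r (A ∩ S) + μ.withDensity r (S \ A) := by
        refine add_le_add le_rfl ?_
        exact hupper.trans ((mul_le_mul_right hdiff t).trans hlower)
    _ = μ.withDensity r S := by rw [Set.inter_comm, measure_inter_add_sdiff S hA]
end

section
/- (Neyman–Pearson upper-set comparison) Let μ be a finite measure on a measurable space Z, let r : Z → [0, ∞] be measurable, and let ν = μ.withDensity r. Fix t ∈ [0, ∞) and let S' = {z : r(z) ≥ t}. Then for every measurable set S with μ(S) ≤ μ(S'), one has ν(S) ≤ ν(S'). -/
open MeasureTheory
open scoped ENNReal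

/-- Neyman–Pearson upper-set comparison: among all measurable sets of at most a given
`μ`-measure, a superlevel set of the density `r` maximizes the `μ.withDensity r`-measure. -/
theorem neymanPearson_upperSet {Z : Type*} [MeasurableSpace Z]
    (μ : Measure Z) [IsFiniteMeasure μ]
    (r : Z → ℝ≥0∞) (hr : Measurable r) (t : ℝ≥0∞) (ht : t ≠ ∞)
    (S : Set Z) (hS : MeasurableSet S)
    (hμ : μ S ≤ μ {z | t ≤ r z}) :
    (μ.withDensity r) S ≤ (μ.withDensity r) {z | t ≤ r z} := by
  set T : Set Z := {z | t ≤ r z}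
  have hT : MeasurableSet T := measurableSet_le measurable_const hr
  have h_diff : μ (S \ T) ≤ μ (T \ S) := by
    rw [← measure_inter_add_sdiff S hT, ← measure_inter_add_sdiff T hS, Set.inter_comm T S] at hμ
    exact (ENNReal.add_le_add_iff_left (measure_ne_top μ _)).1 hμ
  rw [← measure_inter_add_sdiff S hT, ← measure_inter_add_sdiff T hS, Set.inter_comm T S]
  gcongr 1
  rw [withDensity_apply _ (hS.diff hT), withDensity_apply _ (hT.diff hS)]
  calc ∫⁻ z in S \ T, r z ∂μ
      ≤ ∫⁻ _ in S \ T, t ∂μ :=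
        setLIntegral_mono measurable_const fun z hz => (not_le.1 hz.2).le
    _ = t * μ (S \ T) := setLIntegral_const _ _
    _ ≤ t * μ (T \ S) := by gcongr
    _ = ∫⁻ _ in T \ S, t ∂μ := (setLIntegral_const _ _).symm
    _ ≤ ∫⁻ z in T \ S, r z ∂μ := setLIntegral_mono hr fun z hz => hz.1
end
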